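/- For every constant C_0 > 1 there exists n_0 such that for all n ≥ n_0 the following holds. Suppose hyperplanes with normals v_1,…,v_k ∈ ℝ^n and constants μ_1,…,μ_k form an essential cover of the n-cube with k ≤ n^{0.52}/10, and let V be the k × n matrix with rows v_1,…,v_k. Then there is a partition of the rows [k] = K_1 ∪ K_2 ∪ K_3 ∪ K_4 and a partition of the columns [n] = N_1 ∪ N_2 ∪ N_3 with |N_1| ≥ n/2 such that: (1) every column of V in N_1 ∪ N_2 has at most n^{0.04} nonzero entries; (2) for every i ∈ K_1, all coordinates of v_i in N_1 ∪ N_2 are zero; (3) for every i ∈ K_2, all coordinates of v_i in N_1 are zero and v_i has at least 4|K_2|² nonzero coordinates in N_2; (4) for every i ∈ K_3, the projection v'_i of v_i to the N_1 coordinates is nonzero, and, letting φ_i > 0 be such that ‖φ_i v'_i‖_2 = 1, for every column j ∈ N_1 one has Σ_{i∈K_3} φ_i² (v'_{ij})² < n^{−0.196}; (5) for every i ∈ K_4, the projection of v_i to the N_1 ∪ N_2 coordinates can be partitioned into S = ⌊n^{0.001}⌋ parts with successive ℓ_2-norm ratios at least C_0, the last (smallest) part is nonzero, and the coordinate set of the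 last part contains N_1. -/

import Mathlib

open scoped Classical

/-- Hyperplanes with normals `v i` and constants `μ i` form an essential cover of the
`n`-dimensional hypercube `{-1,1}^n`. -/
def IsEssentialCover (n k : ℕ) (v : Fin k → Fin n → ℝ) (μ : Fin k → ℝ) : Prop :=
  (∀ i, v i ≠ 0) ∧
  (∀ x : Fin n → ℝ, (∀ j, x j = 1 ∨ x j = -1) → ∃ i, ∑ j, x j * v i j = μ i) ∧
  (∀ j, ∃ i, v i j ≠ 0) ∧
  (∀ i, ∃ x : Fin n → ℝ, (∀ j, x j = 1 ∨ x j = -1) ∧ (∑ j, x j * v i j = μ i) ∧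
    ∀ i', i' ≠ i → ∑ j, x j * v i' j ≠ μ i')

/-- Alternating sums over a cube kill products of few affine functions. -/
lemma alt_sum_zero {ι κ : Type*} (I : Finset ι) (β : ι → κ → ℝ) :
    ∀ (U : Finset κ) (α : ι → ℝ), I.card < U.card →
      ∑ W ∈ U.powerset, (-1 : ℝ) ^ W.card * ∏ i ∈ I, (α i + ∑ j ∈ W, β i j) = 0 := by
  induction I using Finset.induction_on with
  | empty =>
    intro U α h
    simp only [Finset.prod_empty, mul_one]
    have h1 : U.Nonempty := Finset.card_pos.mp (by simpa using h)
    have := Finset.sum_powerset_neg_one_pow_card_of_nonempty h1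
    exact_mod_cast this
  | insert a I ha ih =>
    intro U α h
    rw [Finset.card_insert_of_notMem ha] at h
    have key : ∀ W ∈ U.powerset, (-1 : ℝ) ^ W.card * ∏ i ∈ insert a I, (α i + ∑ j ∈ W, β i j)
        = α a * ((-1 : ℝ) ^ W.card * ∏ i ∈ I, (α i + ∑ j ∈ W, β i j))
          + ∑ j ∈ U, β a j * (if j ∈ W then
              ((-1 : ℝ) ^ W.card * ∏ i ∈ I, (α i + ∑ j ∈ W, β i j)) else 0) := by
      intro W hW
      rw [Finset.mem_powerset] at hW
      rw [Finset.prod_insert ha]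
      have : ∑ j ∈ U, β a j * (if j ∈ W then
              ((-1 : ℝ) ^ W.card * ∏ i ∈ I, (α i + ∑ j ∈ W, β i j)) else 0)
          = (∑ j ∈ W, β a j) * ((-1 : ℝ) ^ W.card * ∏ i ∈ I, (α i + ∑ j ∈ W, β i j)) := by
        rw [Finset.sum_mul, ← Finset.sum_subset hW]
        · exact Finset.sum_congr rfl fun j hj => by rw [if_pos hj]
        · intro j _ hj; rw [if_neg hj, mul_zero]
      rw [this]; ring
    rw [Finset.sum_congr rfl key, Finset.sum_add_distrib, ← Finset.mul_sum, ih U α (by omega),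
      mul_zero, zero_add, Finset.sum_comm]
    refine Finset.sum_eq_zero fun j hj => ?_
    rw [← Finset.mul_sum]
    have hj2 : j ∉ U.erase j := Finset.notMem_erase j U
    conv_lhs => rw [← Finset.insert_erase hj]
    rw [Finset.sum_powerset_insert hj2]
    have e1 : ∑ W ∈ (U.erase j).powerset, (if j ∈ W then
              ((-1 : ℝ) ^ W.card * ∏ i ∈ I, (α i + ∑ j ∈ W, β i j)) else 0) = 0 := by
      refine Finset.sum_eq_zero fun W hW => ?_
      rw [if_neg]
      intro hjW
      exact hj2 (Finset.mem_powerset.mp hW hjW)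
    have e2 : ∑ W ∈ (U.erase j).powerset, (if j ∈ insert j W then
              ((-1 : ℝ) ^ (insert j W).card * ∏ i ∈ I, (α i + ∑ j ∈ insert j W, β i j)) else 0)
        = - ∑ W ∈ (U.erase j).powerset, (-1 : ℝ) ^ W.card *
            ∏ i ∈ I, ((α i + β i j) + ∑ j ∈ W, β i j) := by
      rw [← Finset.sum_neg_distrib]
      refine Finset.sum_congr rfl fun W hW => ?_
      have hjW : j ∉ W := fun hjW => hj2 (Finset.mem_powerset.mp hW hjW)
      rw [if_pos (Finset.mem_insert_self j W), Finset.card_insert_of_notMem hjW, pow_succ]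
      have : ∀ i ∈ I, α i + ∑ j ∈ insert j W, β i j = (α i + β i j) + ∑ j ∈ W, β i j := by
        intro i _
        rw [Finset.sum_insert hjW]; ring
      rw [Finset.prod_congr rfl this]; ring
    rw [e1, e2, ih (U.erase j) (fun i => α i + β i j) (by rw [Finset.card_erase_of_mem hj]; omega)]
    simp

/-- Signed half of the support bound. -/
lemma half_support {n k : ℕ} {v : Fin k → Fin n → ℝ} {μ : Fin k → ℝ}
    (hcov : ∀ x : Fin n → ℝ, (∀ j, x j = 1 ∨ x j = -1) → ∃ i, ∑ j, x j * v i j = μ i)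
    (i : Fin k) (x : Fin n → ℝ) (hx : ∀ j, x j = 1 ∨ x j = -1)
    (hxi : ∑ j, x j * v i j = μ i) (hxo : ∀ i', i' ≠ i → ∑ j, x j * v i' j ≠ μ i')
    (U : Finset (Fin n)) (hU : ∀ W ⊆ U, W.Nonempty → ∑ j ∈ W, x j * v i j ≠ 0) :
    U.card ≤ k := by
  by_contra hlt
  push Not at hlt
  have h0 := alt_sum_zero (Finset.univ.erase i) (fun i' j => -2 * (x j * v i' j)) U
    (fun i' => ∑ j, x j * v i' j - μ i')
    (lt_of_le_of_lt (le_trans (Finset.card_le_card (Finset.erase_subset _ _)) (by simp)) hlt)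
  have hflip : ∀ (W : Finset (Fin n)) (i' : Fin k),
      ∑ j, (if j ∈ W then - x j else x j) * v i' j
        = ∑ j, x j * v i' j + ∑ j ∈ W, -2 * (x j * v i' j) := by
    intro W i'
    rw [← Finset.sum_filter_add_sum_filter_not Finset.univ (· ∈ W) (fun j => x j * v i' j),
      ← Finset.sum_filter_add_sum_filter_not Finset.univ (· ∈ W)
        (fun j => (if j ∈ W then - x j else x j) * v i' j)]
    have a1 : ∑ j ∈ Finset.univ.filter (· ∈ W), (if j ∈ W then - x j else x j) * v i' j
        = - ∑ j ∈ W, x j * v i' j := by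
      rw [← Finset.sum_neg_distrib]
      have : Finset.univ.filter (· ∈ W) = W := by ext; simp
      rw [this]
      exact Finset.sum_congr rfl fun j hj => by rw [if_pos hj]; ring
    have a2 : ∑ j ∈ Finset.univ.filter (fun j => ¬ j ∈ W), (if j ∈ W then - x j else x j) * v i' j
        = ∑ j ∈ Finset.univ.filter (fun j => ¬ j ∈ W), x j * v i' j :=
      Finset.sum_congr rfl fun j hj => by rw [if_neg (Finset.mem_filter.mp hj).2]
    have a3 : Finset.univ.filter (· ∈ W) = W := by ext; simp
    rw [a1, a2, a3, ← Finset.mul_sum]; ring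
  rw [Finset.sum_eq_single_of_mem ∅ (Finset.empty_mem_powerset U)] at h0
  · simp only [Finset.card_empty, pow_zero, one_mul, Finset.sum_empty, add_zero] at h0
    rw [Finset.prod_eq_zero_iff] at h0
    obtain ⟨i', hi', h⟩ := h0
    exact hxo i' (Finset.ne_of_mem_erase hi') (by linarith)
  · intro W hW hne
    have hWn : W.Nonempty := Finset.nonempty_iff_ne_empty.mpr hne
    obtain ⟨i', hi'⟩ := hcov (fun j => if j ∈ W then - x j else x j) (by
      intro j
      by_cases hj : j ∈ W
      · simp only [hj, if_true]; rcases hx j with h | h <;> simp [h]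
      · simp only [hj, if_false]; exact hx j)
    rw [hflip] at hi'
    have hne' : i' ≠ i := by
      rintro rfl
      apply hU W (Finset.mem_powerset.mp hW) hWn
      rw [hxi, ← Finset.mul_sum] at hi'
      linarith
    rw [Finset.prod_eq_zero (i := i'), mul_zero]
    · simp [hne']
    · linarith

/-- Linial–Radhakrishnan: every row of an essential cover has at most `2k` nonzero entries. -/
lemma support_le {n k : ℕ} {v : Fin k → Fin n → ℝ} {μ : Fin k → ℝ}
    (h : IsEssentialCover n k v μ) (i : Fin k) :
    (Finset.univ.filter fun j => v i j ≠ 0).card ≤ 2 * k := by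
  obtain ⟨_, hcov, _, hess⟩ := h
  obtain ⟨x, hx, hxi, hxo⟩ := hess i
  have h1 := half_support hcov i x hx hxi hxo (Finset.univ.filter fun j => 0 < x j * v i j) (by
    intro W hW hn
    apply ne_of_gt
    exact Finset.sum_pos (fun j hj => (Finset.mem_filter.mp (hW hj)).2) hn)
  have h2 := half_support hcov i x hx hxi hxo (Finset.univ.filter fun j => x j * v i j < 0) (by
    intro W hW hn
    apply ne_of_lt
    exact Finset.sum_neg (fun j hj => (Finset.mem_filter.mp (hW hj)).2) hn)
  have h3 : (Finset.univ.filter fun j => v i j ≠ 0) ⊆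
      (Finset.univ.filter fun j => 0 < x j * v i j) ∪
        (Finset.univ.filter fun j => x j * v i j < 0) := by
    intro j hj
    simp only [Finset.mem_filter, Finset.mem_univ, true_and, Finset.mem_union] at hj ⊢
    have : x j * v i j ≠ 0 := mul_ne_zero (by rcases hx j with h | h <;> rw [h] <;> norm_num) hj
    rcases lt_or_gt_of_ne this with h | h
    · exact Or.inr h
    · exact Or.inl h
  have := (Finset.card_le_card h3).trans (Finset.card_union_le _ _)
  omega

/-- `u` restricted to `A` is split in `s` scales, the last part being exactly `T`. -/
def Scales {n : ℕ} (C : ℝ) (u : Fin n → ℝ) (A : Finset (Fin n)) (s : ℕ) (T : Finset (Fin n)) :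
    Prop :=
  ∃ part : Fin n → ℕ, (∀ j ∈ A, part j ∈ Finset.Icc 1 s) ∧
    (∀ t : ℕ, 1 ≤ t → t < s →
      C ^ 2 * (∑ j ∈ A.filter fun j => part j = t + 1, u j ^ 2)
        ≤ ∑ j ∈ A.filter fun j => part j = t, u j ^ 2) ∧
    (A.filter fun j => part j = s) = T

lemma Scales.extend {n : ℕ} {C : ℝ} {u : Fin n → ℝ} {A : Finset (Fin n)} {s : ℕ}
    {T : Finset (Fin n)} (h : Scales C u A s T) (hs : 1 ≤ s) (M : Finset (Fin n)) (hM : M ⊆ T)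
    (hmass : (1 + C ^ 2) * ∑ j ∈ M, u j ^ 2 ≤ ∑ j ∈ T, u j ^ 2) : Scales C u A (s + 1) M := by
  obtain ⟨part, h1, h2, h3⟩ := h
  have hTA : T ⊆ A := h3 ▸ Finset.filter_subset _ _
  have hTs : ∀ j ∈ T, part j = s := fun j hj => by
    rw [← h3] at hj; exact (Finset.mem_filter.mp hj).2
  have f1 : ∀ t, t < s → (A.filter fun j => (if j ∈ M then s + 1 else part j) = t)
      = A.filter fun j => part j = t := by
    intro t ht
    apply Finset.filter_congr
    intro j _
    by_cases hj : j ∈ M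
    · have := hTs j (hM hj)
      simp only [hj, if_true]; omega
    · simp only [hj, if_false]
  have f2 : (A.filter fun j => (if j ∈ M then s + 1 else part j) = s) = T \ M := by
    ext j
    rw [← h3]
    by_cases hj : j ∈ M <;> simp [hj]
  have f3 : (A.filter fun j => (if j ∈ M then s + 1 else part j) = s + 1) = M := by
    ext j
    by_cases hj : j ∈ M
    · simp [hj, hTA (hM hj)]
    · simp only [hj, if_false, Finset.mem_filter, iff_false, not_and]
      intro hA
      have := Finset.mem_Icc.mp (h1 j hA)
      omega
  have hsplit := Finset.sum_sdiff (f := fun j => u j ^ 2) hM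
  refine ⟨fun j => if j ∈ M then s + 1 else part j, ?_, ?_, f3⟩
  · intro j hj
    have := Finset.mem_Icc.mp (h1 j hj)
    rw [Finset.mem_Icc]
    by_cases hj : j ∈ M <;> simp only [hj, if_true, if_false] <;> omega
  · intro t ht1 ht2
    rcases Nat.lt_or_ge t s with hts | hts
    · rw [f1 t hts]
      rcases Nat.lt_or_ge (t + 1) s with hts' | hts'
      · rw [f1 _ hts']; exact h2 t ht1 hts
      · have : t + 1 = s := by omega
        rw [this, f2]
        refine le_trans ?_ (h2 t ht1 hts)
        rw [this, h3]
        apply mul_le_mul_of_nonneg_left _ (sq_nonneg C)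
        exact Finset.sum_le_sum_of_subset_of_nonneg Finset.sdiff_subset
          fun _ _ _ => sq_nonneg _
    · have : t = s := by omega
      subst this
      rw [f2, f3]
      linarith

/-- Row `u` has many (`S`) scales, with `M` inside the last one. -/
def ManyScales {n : ℕ} (C : ℝ) (S : ℕ) (u : Fin n → ℝ) (A M : Finset (Fin n)) : Prop :=
  ∃ T, M ⊆ T ∧ 0 < ∑ j ∈ T, u j ^ 2 ∧ Scales C u A S T

/-- Invariant of the peeling process, with budget `x`. -/
def RowInv {n : ℕ} (C : ℝ) (S : ℕ) (u : Fin n → ℝ) (A M : Finset (Fin n)) (x : ℝ) : Prop :=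
  ((∀ j ∈ M, u j = 0) ∧ x ≤ S * (1 + C ^ 2)) ∨
  (ManyScales C S u A M ∧ x ≤ S * (1 + C ^ 2)) ∨
  (∃ s T, 1 ≤ s ∧ s < S ∧ M ⊆ T ∧ Scales C u A s T ∧ 0 < ∑ j ∈ M, u j ^ 2 ∧
    (∑ j ∈ T, u j ^ 2) < (1 + C ^ 2) * ∑ j ∈ M, u j ^ 2 ∧
    x ≤ ((s : ℝ) - 1) * (1 + C ^ 2) +
      (1 + C ^ 2) * ((∑ j ∈ T, u j ^ 2) - ∑ j ∈ M, u j ^ 2) / (∑ j ∈ T, u j ^ 2))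

lemma RowInv.le {n : ℕ} {C : ℝ} {S : ℕ} {u : Fin n → ℝ} {A M : Finset (Fin n)} {x : ℝ}
    (h : RowInv C S u A M x) : x ≤ S * (1 + C ^ 2) := by
  rcases h with h | h | ⟨s, T, hs1, hs2, hMT, hsc, hpos, hlt, hx⟩
  · exact h.2
  · exact h.2
  · have hle : ∑ j ∈ M, u j ^ 2 ≤ ∑ j ∈ T, u j ^ 2 :=
      Finset.sum_le_sum_of_subset_of_nonneg hMT fun _ _ _ => sq_nonneg _
    have hT : 0 < ∑ j ∈ T, u j ^ 2 := by linarith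
    have hD : 0 < 1 + C ^ 2 := by positivity
    have h1 : (1 + C ^ 2) * ((∑ j ∈ T, u j ^ 2) - ∑ j ∈ M, u j ^ 2) / (∑ j ∈ T, u j ^ 2)
        ≤ 1 + C ^ 2 := by
      rw [div_le_iff₀ hT]
      nlinarith
    have h2 : (s : ℝ) ≤ S := by exact_mod_cast hs2.le
    nlinarith

lemma RowInv.base {n : ℕ} (C : ℝ) (hC : 1 < C) (S : ℕ) (hS : 1 ≤ S) (u : Fin n → ℝ) (A : Finset (Fin n)) :
    RowInv C S u A A 0 := by
  by_cases h0 : ∀ j ∈ A, u j = 0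
  · left; exact ⟨h0, by positivity⟩
  · push Not at h0
    obtain ⟨j, hj, hne⟩ := h0
    have hpos : 0 < ∑ j ∈ A, u j ^ 2 :=
      Finset.sum_pos' (fun _ _ => sq_nonneg _) ⟨j, hj, by positivity⟩
    have hsc : Scales C u A 1 A := by
      refine ⟨fun _ => 1, by simp, ?_, by simp⟩
      intro t h1 h2; omega
    right
    rcases Nat.lt_or_ge 1 S with h | h
    · right
      refine ⟨1, A, le_rfl, h, subset_rfl, hsc, hpos, ?_, by simp⟩
      have : 0 < C ^ 2 := by positivity
      nlinarith
    · left
      have : S = 1 := by omega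
      subst this
      exact ⟨⟨A, subset_rfl, hpos, hsc⟩, by positivity⟩

lemma RowInv.step {n : ℕ} {C : ℝ} (hC : 1 < C) {S : ℕ} {u : Fin n → ℝ} {A M : Finset (Fin n)}
    {x : ℝ} (h : RowInv C S u A M x) (j : Fin n) (hj : j ∈ M) :
    RowInv C S u A (M.erase j)
      (x + if ¬ ManyScales C S u A M ∧ ∃ j ∈ M, u j ≠ 0 then u j ^ 2 / ∑ j ∈ M, u j ^ 2
        else 0) := by
  have hsub : M.erase j ⊆ M := Finset.erase_subset _ _
  rcases h with h | h | ⟨s, T, hs1, hs2, hMT, hsc, hpos, hlt, hx⟩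
  · left
    rw [if_neg (by rintro ⟨_, j, hj, hne⟩; exact hne (h.1 j hj)), add_zero]
    exact ⟨fun j hj => h.1 j (hsub hj), h.2⟩
  · right; left
    rw [if_neg (by rintro ⟨h', _⟩; exact h' h.1), add_zero]
    obtain ⟨⟨T, hT, h'⟩, h2⟩ := h
    exact ⟨⟨T, hsub.trans hT, h'⟩, h2⟩
  · have hw : ∑ j ∈ M.erase j, u j ^ 2 + u j ^ 2 = ∑ j ∈ M, u j ^ 2 :=
      Finset.sum_erase_add M (fun j => u j ^ 2) hj
    have hw0 : 0 ≤ ∑ j ∈ M.erase j, u j ^ 2 := Finset.sum_nonneg fun _ _ => sq_nonneg _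
    have hle : ∑ j ∈ M, u j ^ 2 ≤ ∑ j ∈ T, u j ^ 2 :=
      Finset.sum_le_sum_of_subset_of_nonneg hMT fun _ _ _ => sq_nonneg _
    have hif : (if ¬ ManyScales C S u A M ∧ ∃ j ∈ M, u j ≠ 0 then u j ^ 2 / ∑ j ∈ M, u j ^ 2
        else 0) ≤ u j ^ 2 / ∑ j ∈ M, u j ^ 2 := by
      split_ifs
      · exact le_rfl
      · positivity
    have hzero : ∑ j ∈ M.erase j, u j ^ 2 = 0 → ∀ l ∈ M.erase j, u l = 0 := by
      intro h l hl
      have := (Finset.sum_eq_zero_iff_of_nonneg (fun _ _ => sq_nonneg _)).mp h l hl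
      exact pow_eq_zero_iff (two_ne_zero) |>.mp this
    generalize (if ¬ ManyScales C S u A M ∧ ∃ j ∈ M, u j ≠ 0 then u j ^ 2 / ∑ j ∈ M, u j ^ 2
        else 0) = y at hif ⊢
    have hext := fun h => hsc.extend hs1 (M.erase j) (hsub.trans hMT) h
    have hTT : M.erase j ⊆ T := hsub.trans hMT
    unfold RowInv ManyScales
    generalize hb : ∑ j ∈ T, u j ^ 2 = b at *
    generalize hwM : ∑ j ∈ M, u j ^ 2 = w at *
    generalize hwE : ∑ j ∈ M.erase j, u j ^ 2 = w' at *
    have hbpos : 0 < b := by linarith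
    have hDpos : 0 < 1 + C ^ 2 := by positivity
    have hD1 : 1 < 1 + C ^ 2 := by nlinarith
    have hxy : x + y ≤ ((s : ℝ) - 1) * (1 + C ^ 2) + (1 + C ^ 2) * (b - w') / b := by
      have : u j ^ 2 / w ≤ (1 + C ^ 2) * u j ^ 2 / b := by
        rw [div_le_div_iff₀ hpos hbpos]
        nlinarith [sq_nonneg (u j)]
      have e : (1 + C ^ 2) * (b - w') / b
          = (1 + C ^ 2) * (b - w) / b + (1 + C ^ 2) * u j ^ 2 / b := by
        rw [← add_div]; congr 1; rw [← hw]; ring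
      linarith
    have hxy' : x + y ≤ s * (1 + C ^ 2) := by
      have : (1 + C ^ 2) * (b - w') / b ≤ 1 + C ^ 2 := by
        rw [div_le_iff₀ hbpos]
        nlinarith
      nlinarith
    have hxyS : x + y ≤ S * (1 + C ^ 2) := by
      have h2 : (s : ℝ) ≤ S := by exact_mod_cast hs2.le
      nlinarith
    rcases hw0.eq_or_lt with h0 | h0
    · left
      exact ⟨hzero h0.symm, hxyS⟩
    · right
      rcases le_or_gt ((1 + C ^ 2) * w') b with hcase | hcase
      · have hsc' := hext hcase
        rcases Nat.lt_or_ge (s + 1) S with hS | hS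
        · right
          refine ⟨s + 1, M.erase j, by omega, hS, subset_rfl, hsc', h0, ?_, ?_⟩
          · rw [hwE]; nlinarith
          · rw [hwE]; push_cast; simpa using hxy'
        · left
          have : s + 1 = S := by omega
          rw [this] at hsc'
          exact ⟨⟨M.erase j, subset_rfl, by rw [hwE]; exact h0, hsc'⟩, hxyS⟩
      · right
        refine ⟨s, T, hs1, hs2, hTT, hsc, h0, by rw [hb]; exact hcase, by rw [hb]; exact hxy⟩

/-- The peeling lemma. -/
lemma peel {n k : ℕ} {C : ℝ} (hC : 1 < C) {S : ℕ} (hS : 1 ≤ S) (v : Fin k → Fin n → ℝ)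
    (A : Finset (Fin n)) (τ : ℝ) :
    ∃ N2 ⊆ A, τ * N2.card ≤ k * (S * (1 + C ^ 2)) ∧
      ∀ j ∈ A \ N2, ∑ i ∈ Finset.univ.filter
        (fun i => ¬ ManyScales C S (v i) A (A \ N2) ∧ ∃ j ∈ A \ N2, v i j ≠ 0),
          v i j ^ 2 / (∑ j ∈ A \ N2, v i j ^ 2) < τ := by
  obtain ⟨N2, hN2, hmax⟩ := Finset.exists_max_image
    (A.powerset.filter fun N2 => ∃ x : Fin k → ℝ, (∀ i, RowInv C S (v i) A (A \ N2) (x i)) ∧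
      τ * N2.card ≤ ∑ i, x i) Finset.card
    ⟨∅, by
      rw [Finset.mem_filter]
      refine ⟨Finset.empty_mem_powerset _, fun _ => 0, fun i => ?_, by simp⟩
      rw [Finset.sdiff_empty]
      exact RowInv.base C hC S hS (v i) A⟩
  obtain ⟨hsub, x, hx, hxs⟩ := Finset.mem_filter.mp hN2
  rw [Finset.mem_powerset] at hsub
  refine ⟨N2, hsub, ?_, ?_⟩
  · refine hxs.trans ((Finset.sum_le_sum fun i _ => (hx i).le).trans ?_)
    simp
  · intro j hj
    by_contra hcon
    push Not at hcon
    have hjN : j ∉ N2 := (Finset.mem_sdiff.mp hj).2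
    have := hmax (insert j N2) (by
      rw [Finset.mem_filter, Finset.mem_powerset]
      refine ⟨Finset.insert_subset (Finset.mem_sdiff.mp hj).1 hsub, ?_⟩
      have e : A \ insert j N2 = (A \ N2).erase j := by
        ext l; simp only [Finset.mem_sdiff, Finset.mem_insert, Finset.mem_erase]; tauto
      rw [e]
      refine ⟨_, fun i => (hx i).step hC j hj, ?_⟩
      rw [Finset.sum_add_distrib, ← Finset.sum_filter, Finset.card_insert_of_notMem hjN]
      push_cast
      linarith)
    rw [Finset.card_insert_of_notMem hjN] at this
    omega

/-- Analytic facts for large `n`. -/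
lemma large_facts (C : ℝ) : ∃ n0 : ℕ, ∀ n : ℕ, n0 ≤ n → 1 ≤ n ∧
    1 + C ^ 2 ≤ 5 * (n : ℝ) ^ (0.003 : ℝ) ∧ 2 ≤ (n : ℝ) ^ (0.28 : ℝ) := by
  have h := (tendsto_rpow_atTop (y := (0.003 : ℝ)) (by norm_num)).comp
    (tendsto_natCast_atTop_atTop (R := ℝ))
  have h' := (tendsto_rpow_atTop (y := (0.28 : ℝ)) (by norm_num)).comp
    (tendsto_natCast_atTop_atTop (R := ℝ))
  have h1 := ((h.eventually_ge_atTop (1 + C ^ 2)).and (h'.eventually_ge_atTop 2)).and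
    (Filter.eventually_ge_atTop 1)
  obtain ⟨n0, hn0⟩ := Filter.eventually_atTop.mp h1
  refine ⟨n0, fun n hn => ⟨(hn0 n hn).2, ?_, (hn0 n hn).1.2⟩⟩
  have := (hn0 n hn).1.1
  simp only [Function.comp] at this
  have : 0 ≤ (n : ℝ) ^ (0.003 : ℝ) := by positivity
  linarith

/-- Few columns are dense. -/
lemma bad_columns {n k : ℕ} (hn : 1 ≤ n) {v : Fin k → Fin n → ℝ} {μ : Fin k → ℝ}
    (h : IsEssentialCover n k v μ) (hk : (k : ℝ) ≤ (n : ℝ) ^ (0.52 : ℝ) / 10) :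
    ((Finset.univ.filter fun j => (n : ℝ) ^ (0.04 : ℝ) <
      ((Finset.univ.filter fun i => v i j ≠ 0).card : ℝ)).card : ℝ) ≤ n / 50 := by
  have hn0 : (0 : ℝ) < n := by exact_mod_cast hn
  set Bad := Finset.univ.filter fun j => (n : ℝ) ^ (0.04 : ℝ) <
      ((Finset.univ.filter fun i => v i j ≠ 0).card : ℝ) with hBad
  have h1 : (Bad.card : ℝ) * (n : ℝ) ^ (0.04 : ℝ) ≤
      ∑ j, ((Finset.univ.filter fun i => v i j ≠ 0).card : ℝ) := by
    calc (Bad.card : ℝ) * (n : ℝ) ^ (0.04 : ℝ) = ∑ j ∈ Bad, (n : ℝ) ^ (0.04 : ℝ) := by simp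
      _ ≤ ∑ j ∈ Bad, ((Finset.univ.filter fun i => v i j ≠ 0).card : ℝ) :=
        Finset.sum_le_sum fun j hj => (Finset.mem_filter.mp hj).2.le
      _ ≤ _ := Finset.sum_le_sum_of_subset_of_nonneg (Finset.subset_univ _)
        fun _ _ _ => by positivity
  have h2 : ∑ j, (Finset.univ.filter fun i => v i j ≠ 0).card
      = ∑ i, (Finset.univ.filter fun j => v i j ≠ 0).card := by
    simp only [Finset.card_filter]
    exact Finset.sum_comm
  have h3 : ∑ i, (Finset.univ.filter fun j => v i j ≠ 0).card ≤ k * (2 * k) :=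
    (Finset.sum_le_sum fun i _ => support_le h i).trans (by simp)
  have h4 : (Bad.card : ℝ) * (n : ℝ) ^ (0.04 : ℝ) ≤ k * (2 * k) := by
    refine h1.trans ?_
    rw [← h2] at h3
    exact_mod_cast h3
  have h5 : (k : ℝ) * (2 * k) ≤ n / 50 * (n : ℝ) ^ (0.04 : ℝ) := by
    have e : (n : ℝ) ^ (0.52 : ℝ) * (n : ℝ) ^ (0.52 : ℝ) = n * (n : ℝ) ^ (0.04 : ℝ) := by
      rw [← Real.rpow_add hn0]
      nth_rewrite 2 [← Real.rpow_one (n : ℝ)]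
      rw [← Real.rpow_add hn0]; norm_num
    have : (k : ℝ) * k ≤ (n : ℝ) ^ (0.52 : ℝ) / 10 * ((n : ℝ) ^ (0.52 : ℝ) / 10) :=
      mul_le_mul hk hk (by positivity) (by positivity)
    nlinarith
  have hp : 0 < (n : ℝ) ^ (0.04 : ℝ) := by positivity
  exact le_of_mul_le_mul_right (h4.trans h5) hp

/-- The main structural lemma: for every constant `C₀ > 1` and all large `n`, if the
hyperplanes `⟨·, v_i⟩ = μ_i` form an essential cover of the `n`-cube with `k ≤ n^{0.52}/10`,
then the rows `[k]` can be partitioned into `K₁ ∪ K₂ ∪ K₃ ∪ K₄` and the columns `[n]` into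
`N₁ ∪ N₂ ∪ N₃` with `|N₁| ≥ n/2`, satisfying properties (1)–(5) of the lemma. -/
theorem main_decomposition (C0 : ℝ) (hC0 : 1 < C0) :
    ∃ n0 : ℕ, ∀ n : ℕ, n0 ≤ n →
      ∀ (k : ℕ) (v : Fin k → Fin n → ℝ) (μ : Fin k → ℝ),
        IsEssentialCover n k v μ →
        (k : ℝ) ≤ (n : ℝ) ^ (0.52 : ℝ) / 10 →
        ∃ (K1 K2 K3 K4 : Finset (Fin k)) (N1 N2 N3 : Finset (Fin n)),
          -- the rows are partitioned into K1, K2, K3, K4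
          (K1 ∪ K2 ∪ K3 ∪ K4 = Finset.univ) ∧
          Disjoint K1 K2 ∧ Disjoint K1 K3 ∧ Disjoint K1 K4 ∧
          Disjoint K2 K3 ∧ Disjoint K2 K4 ∧ Disjoint K3 K4 ∧
          -- the columns are partitioned into N1, N2, N3
          (N1 ∪ N2 ∪ N3 = Finset.univ) ∧
          Disjoint N1 N2 ∧ Disjoint N1 N3 ∧ Disjoint N2 N3 ∧
          -- N1 is large
          (n : ℝ) / 2 ≤ (N1.card : ℝ) ∧
          -- (1) every column in N1 ∪ N2 has sparsity at most n^{0.04}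
          (∀ j ∈ N1 ∪ N2,
            ((Finset.univ.filter fun i => v i j ≠ 0).card : ℝ) ≤ (n : ℝ) ^ (0.04 : ℝ)) ∧
          -- (2) rows in K1 vanish on N1 ∪ N2
          (∀ i ∈ K1, ∀ j ∈ N1 ∪ N2, v i j = 0) ∧
          -- (3) rows in K2 vanish on N1 and have at least 4|K2|² nonzero entries in N2
          (∀ i ∈ K2, (∀ j ∈ N1, v i j = 0) ∧
            4 * K2.card ^ 2 ≤ (N2.filter fun j => v i j ≠ 0).card) ∧
          -- (4) rows in K3 are nonzero on N1, and after normalization on N1 every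
          -- column of N1 has small squared mass
          (∃ φ : Fin k → ℝ,
            (∀ i ∈ K3, 0 < φ i ∧ (∃ j ∈ N1, v i j ≠ 0) ∧
              ∑ j ∈ N1, (φ i * v i j) ^ 2 = 1) ∧
            (∀ j ∈ N1, ∑ i ∈ K3, φ i ^ 2 * v i j ^ 2 < (n : ℝ) ^ (-(0.196 : ℝ)))) ∧
          -- (5) rows in K4, projected to N1 ∪ N2, have many scales with nonzero smallest
          -- scale whose position contains N1
          (∀ i ∈ K4, ∃ part : Fin n → ℕ,
            (∀ j ∈ N1 ∪ N2, part j ∈ Finset.Icc 1 ⌊(n : ℝ) ^ (0.001 : ℝ)⌋₊) ∧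
            (∀ s : ℕ, 1 ≤ s → s < ⌊(n : ℝ) ^ (0.001 : ℝ)⌋₊ →
              C0 * Real.sqrt (∑ j ∈ (N1 ∪ N2).filter fun j => part j = s + 1, v i j ^ 2)
                ≤ Real.sqrt (∑ j ∈ (N1 ∪ N2).filter fun j => part j = s, v i j ^ 2)) ∧
            (0 < ∑ j ∈ (N1 ∪ N2).filter
                (fun j => part j = ⌊(n : ℝ) ^ (0.001 : ℝ)⌋₊), v i j ^ 2) ∧
            (∀ j ∈ N1, part j = ⌊(n : ℝ) ^ (0.001 : ℝ)⌋₊)) := by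
  obtain ⟨n0, hn0⟩ := large_facts C0
  refine ⟨n0, fun n hn k v μ hcover hk => ?_⟩
  obtain ⟨hn1, hlarge, hlarge2⟩ := hn0 n hn
  have hnpos : (0 : ℝ) < n := by exact_mod_cast hn1
  have hn1' : (1 : ℝ) ≤ n := by exact_mod_cast hn1
  have hBadcard := bad_columns hn1 hcover hk
  set Bad := Finset.univ.filter fun j => (n : ℝ) ^ (0.04 : ℝ) <
      ((Finset.univ.filter fun i => v i j ≠ 0).card : ℝ) with hBad
  set S := ⌊(n : ℝ) ^ (0.001 : ℝ)⌋₊ with hSdef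
  have hS1 : 1 ≤ S := by
    rw [hSdef, Nat.one_le_floor_iff]
    exact Real.one_le_rpow hn1' (by norm_num)
  have hSle : (S : ℝ) ≤ (n : ℝ) ^ (0.001 : ℝ) := Nat.floor_le (by positivity)
  set B : ℝ := (n : ℝ) ^ (0.48 : ℝ) with hB
  have hBpos : 0 < B := by positivity
  have hkB : k * B ≤ n / 10 := by
    have e : (n : ℝ) ^ (0.52 : ℝ) * B = n := by
      rw [hB, ← Real.rpow_add hnpos]; norm_num
    nlinarith
  -- the dead rows
  let dead : Finset (Fin n) → Finset (Fin k) := fun N =>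
    Finset.univ.filter fun i => ∀ j, j ∉ N → v i j = 0
  obtain ⟨N3, hN3, hmax⟩ := Finset.exists_max_image
    (Finset.univ.filter fun N : Finset (Fin n) => Bad ⊆ N ∧
      (N.card : ℝ) ≤ Bad.card + (dead N).card * B) Finset.card
    ⟨Bad, by
      rw [Finset.mem_filter]
      refine ⟨Finset.mem_univ _, subset_rfl, ?_⟩
      have : 0 ≤ ((dead Bad).card : ℝ) * B := by positivity
      linarith⟩
  obtain ⟨-, hBN, hN3card⟩ := Finset.mem_filter.mp hN3
  -- any enlargement of `N3` violates the budget
  have hgrow : ∀ X : Finset (Fin n), ∀ Z : Finset (Fin k), Disjoint X N3 → X.Nonempty →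
      (∀ i ∈ Z, (i ∉ dead N3) ∧ ∀ j, j ∉ N3 → j ∉ X → v i j = 0) →
      (Z.card : ℝ) * B < X.card := by
    intro X Z hd hX hZ
    by_contra hcon
    push Not at hcon
    have hc : (N3 ∪ X).card = N3.card + X.card := Finset.card_union_of_disjoint hd.symm
    have hdz : dead N3 ∪ Z ⊆ dead (N3 ∪ X) := by
      intro i hi
      rw [Finset.mem_filter]
      refine ⟨Finset.mem_univ _, fun j hj => ?_⟩
      rw [Finset.mem_union, not_or] at hj
      rcases Finset.mem_union.mp hi with hi | hi
      · exact (Finset.mem_filter.mp hi).2 j hj.1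
      · exact (hZ i hi).2 j hj.1 hj.2
    have hdj : Disjoint (dead N3) Z := by
      rw [Finset.disjoint_right]
      exact fun i hi => (hZ i hi).1
    have hdc := Finset.card_le_card hdz
    rw [Finset.card_union_of_disjoint hdj] at hdc
    have hdc' : ((dead N3).card : ℝ) + Z.card ≤ (dead (N3 ∪ X)).card := by exact_mod_cast hdc
    have := hmax (N3 ∪ X) (by
      rw [Finset.mem_filter]
      refine ⟨Finset.mem_univ _, hBN.trans Finset.subset_union_left, ?_⟩
      rw [hc]; push_cast
      nlinarith)
    have := hX.card_pos
    omega
  set A := Finset.univ \ N3 with hA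
  have hmemA : ∀ j, j ∈ A ↔ j ∉ N3 := by intro j; simp [hA]
  -- alive rows have large support
  have halive : ∀ i, i ∉ dead N3 → B ≤ ((A.filter fun j => v i j ≠ 0).card : ℝ) := by
    intro i hi
    have := hgrow (A.filter fun j => v i j ≠ 0) {i} (by
        rw [Finset.disjoint_left]
        intro j hj
        exact (hmemA j).mp (Finset.mem_filter.mp hj).1) (by
        simp only [dead, Finset.mem_filter, Finset.mem_univ, true_and, not_forall] at hi
        obtain ⟨j, hj, hne⟩ := hi
        exact ⟨j, Finset.mem_filter.mpr ⟨(hmemA j).mpr hj, hne⟩⟩) (by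
        intro i' hi'
        rw [Finset.mem_singleton] at hi'
        subst hi'
        refine ⟨hi, fun j hj hj2 => ?_⟩
        by_contra hne
        exact hj2 (Finset.mem_filter.mpr ⟨(hmemA j).mpr hj, hne⟩))
    simp at this
    exact this.le
  obtain ⟨N2, hN2A, hN2card, hcol⟩ := peel hC0 hS1 v A ((n : ℝ) ^ (-(0.196 : ℝ)))
  set N1 := A \ N2 with hN1
  have hU : N1 ∪ N2 = A := Finset.sdiff_union_of_subset hN2A
  set K4 := Finset.univ.filter fun i => ManyScales C0 S (v i) A N1 with hK4
  set K3 := Finset.univ.filter fun i => ¬ ManyScales C0 S (v i) A N1 ∧ ∃ j ∈ N1, v i j ≠ 0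
    with hK3
  set K1 := Finset.univ.filter fun i => ¬ ManyScales C0 S (v i) A N1 ∧
    (∀ j ∈ N1, v i j = 0) ∧ i ∈ dead N3 with hK1
  set K2 := Finset.univ.filter fun i => ¬ ManyScales C0 S (v i) A N1 ∧
    (∀ j ∈ N1, v i j = 0) ∧ i ∉ dead N3 with hK2
  -- size of N2
  have hN2le : (N2.card : ℝ) ≤ (n : ℝ) ^ (0.72 : ℝ) / 2 := by
    have e1 : (n : ℝ) ^ (-(0.196 : ℝ)) * (n : ℝ) ^ (0.196 : ℝ) = 1 := by
      rw [← Real.rpow_add hnpos]; norm_num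
    have e2 : (n : ℝ) ^ (0.52 : ℝ) * (n : ℝ) ^ (0.001 : ℝ) * (n : ℝ) ^ (0.003 : ℝ)
        * (n : ℝ) ^ (0.196 : ℝ) = (n : ℝ) ^ (0.72 : ℝ) := by
      rw [← Real.rpow_add hnpos, ← Real.rpow_add hnpos, ← Real.rpow_add hnpos]; norm_num
    have h1 : (k : ℝ) * (S * (1 + C0 ^ 2)) ≤
        (n : ℝ) ^ (0.52 : ℝ) / 10 * ((n : ℝ) ^ (0.001 : ℝ) * (5 * (n : ℝ) ^ (0.003 : ℝ))) := by
      gcongr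
    have h2 := mul_le_mul_of_nonneg_right (hN2card.trans h1)
      (by positivity : (0 : ℝ) ≤ (n : ℝ) ^ (0.196 : ℝ))
    have h3 : (n : ℝ) ^ (-(0.196 : ℝ)) * N2.card * (n : ℝ) ^ (0.196 : ℝ) = N2.card := by
      rw [mul_right_comm, e1, one_mul]
    rw [h3] at h2
    refine h2.trans (le_of_eq ?_)
    rw [← e2]; ring
  -- size of K2
  have hK2card : 4 * (K2.card : ℝ) ^ 2 ≤ B := by
    by_contra hcon
    push Not at hcon
    have e : (n : ℝ) ^ (0.24 : ℝ) * (n : ℝ) ^ (0.24 : ℝ) = B := by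
      rw [hB, ← Real.rpow_add hnpos]; norm_num
    have e2 : (n : ℝ) ^ (0.24 : ℝ) * B = (n : ℝ) ^ (0.72 : ℝ) := by
      rw [hB, ← Real.rpow_add hnpos]; norm_num
    have hp : 0 < (n : ℝ) ^ (0.24 : ℝ) := by positivity
    have hz : (n : ℝ) ^ (0.24 : ℝ) < 2 * K2.card := by
      apply lt_of_pow_lt_pow_left₀ 2 (by positivity)
      nlinarith
    have hz0 : (0 : ℝ) < K2.card := by linarith
    have hzne : K2.Nonempty := Finset.card_pos.mp (by exact_mod_cast hz0)
    have := hgrow N2 K2 (by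
        rw [Finset.disjoint_left]
        exact fun j hj => (hmemA j).mp (hN2A hj)) (by
        obtain ⟨i, hi⟩ := hzne
        obtain ⟨-, -, h0, hd⟩ := Finset.mem_filter.mp hi
        simp only [dead, Finset.mem_filter, Finset.mem_univ, true_and, not_forall] at hd
        obtain ⟨j, hj, hne⟩ := hd
        refine ⟨j, ?_⟩
        by_contra hj2
        exact hne (h0 j (Finset.mem_sdiff.mpr ⟨(hmemA j).mpr hj, hj2⟩))) (by
        intro i hi
        obtain ⟨-, -, h0, hd⟩ := Finset.mem_filter.mp hi
        exact ⟨hd, fun j hj hj2 => h0 j (Finset.mem_sdiff.mpr ⟨(hmemA j).mpr hj, hj2⟩)⟩)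
    nlinarith
  refine ⟨K1, K2, K3, K4, N1, N2, N3, ?_, ?_, ?_, ?_, ?_, ?_, ?_, ?_, ?_, ?_, ?_, ?_, ?_, ?_, ?_,
    ?_, ?_⟩
  · ext i
    simp only [hK1, hK2, hK3, hK4, Finset.mem_union, Finset.mem_filter, Finset.mem_univ, true_and,
      iff_true]
    by_cases h1 : ManyScales C0 S (v i) A N1
    · exact Or.inr h1
    · by_cases h2 : ∀ j ∈ N1, v i j = 0
      · by_cases h3 : i ∈ dead N3
        · exact Or.inl (Or.inl (Or.inl ⟨h1, h2, h3⟩))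
        · exact Or.inl (Or.inl (Or.inr ⟨h1, h2, h3⟩))
      · push Not at h2
        exact Or.inl (Or.inr ⟨h1, h2⟩)
  · exact Finset.disjoint_filter.mpr fun i _ h h' => h'.2.2 h.2.2
  · exact Finset.disjoint_filter.mpr fun i _ h h' => by
      obtain ⟨_, j, hj, hne⟩ := h'
      exact hne (h.2.1 j hj)
  · exact Finset.disjoint_filter.mpr fun i _ h h' => h.1 h'
  · exact Finset.disjoint_filter.mpr fun i _ h h' => by
      obtain ⟨_, j, hj, hne⟩ := h'
      exact hne (h.2.1 j hj)
  · exact Finset.disjoint_filter.mpr fun i _ h h' => h.1 h'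
  · exact Finset.disjoint_filter.mpr fun i _ h h' => h.1 h'
  · rw [hU]; exact Finset.sdiff_union_of_subset (Finset.subset_univ _)
  · exact Finset.sdiff_disjoint
  · rw [Finset.disjoint_left]
    exact fun j hj => (hmemA j).mp (Finset.mem_sdiff.mp hj).1
  · rw [Finset.disjoint_left]
    exact fun j hj => (hmemA j).mp (hN2A hj)
  · have c1 : N1.card + N2.card = A.card := Finset.card_sdiff_add_card_eq_card hN2A
    have c2 : A.card + N3.card = n := by
      have := Finset.card_sdiff_add_card_eq_card (Finset.subset_univ N3)
      simpa using this
    have c3 : (N1.card : ℝ) + N2.card + N3.card = n := by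
      rw [← c1] at c2; exact_mod_cast c2
    have c4 : ((dead N3).card : ℝ) ≤ k := by
      have := Finset.card_le_univ (dead N3)
      rw [Fintype.card_fin] at this
      exact_mod_cast this
    have c5 : ((dead N3).card : ℝ) * B ≤ k * B := mul_le_mul_of_nonneg_right c4 hBpos.le
    have c6 : (n : ℝ) ^ (0.28 : ℝ) * (n : ℝ) ^ (0.72 : ℝ) = n := by
      rw [← Real.rpow_add hnpos]; norm_num
    have c7 : 2 * (n : ℝ) ^ (0.72 : ℝ) ≤ n := by
      refine le_of_le_of_eq ?_ c6
      gcongr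
    linarith
  · intro j hj
    rw [hU, hmemA] at hj
    by_contra hcon
    push Not at hcon
    exact hj (hBN (Finset.mem_filter.mpr ⟨Finset.mem_univ _, hcon⟩))
  · intro i hi j hj
    rw [hU, hmemA] at hj
    obtain ⟨-, -, -, hd⟩ := Finset.mem_filter.mp hi
    exact (Finset.mem_filter.mp hd).2 j hj
  · intro i hi
    obtain ⟨-, -, h0, hd⟩ := Finset.mem_filter.mp hi
    refine ⟨h0, ?_⟩
    have h1 := halive i hd
    have h2 : (A.filter fun j => v i j ≠ 0) ⊆ N2.filter fun j => v i j ≠ 0 := by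
      intro j hj
      obtain ⟨hjA, hne⟩ := Finset.mem_filter.mp hj
      refine Finset.mem_filter.mpr ⟨?_, hne⟩
      by_contra hj2
      exact hne (h0 j (Finset.mem_sdiff.mpr ⟨hjA, hj2⟩))
    have h3 : ((A.filter fun j => v i j ≠ 0).card : ℝ) ≤ (N2.filter fun j => v i j ≠ 0).card := by
      exact_mod_cast Finset.card_le_card h2
    have h4 := (hK2card.trans h1).trans h3
    exact_mod_cast h4
  · have hpos : ∀ i ∈ K3, 0 < ∑ j ∈ N1, v i j ^ 2 := by
      intro i hi
      obtain ⟨-, -, j, hj, hne⟩ := Finset.mem_filter.mp hi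
      exact Finset.sum_pos' (fun _ _ => sq_nonneg _) ⟨j, hj, by positivity⟩
    refine ⟨fun i => (Real.sqrt (∑ j ∈ N1, v i j ^ 2))⁻¹, ?_, ?_⟩
    · intro i hi
      have hp := hpos i hi
      refine ⟨inv_pos.mpr (Real.sqrt_pos.mpr hp), (Finset.mem_filter.mp hi).2.2, ?_⟩
      simp only [mul_pow]
      rw [← Finset.mul_sum, inv_pow, Real.sq_sqrt hp.le, inv_mul_cancel₀ hp.ne']
    · intro j hj
      refine lt_of_eq_of_lt ?_ (hcol j hj)
      refine Finset.sum_congr rfl fun i hi => ?_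
      rw [inv_pow, Real.sq_sqrt (hpos i hi).le]
      ring
  · intro i hi
    obtain ⟨T, hT, hTpos, part, h1, h2, h3⟩ := (Finset.mem_filter.mp hi).2
    rw [hU]
    refine ⟨part, h1, ?_, ?_, ?_⟩
    · intro s hs1 hs2
      have hC : 0 ≤ C0 := by linarith
      have := Real.sqrt_le_sqrt (h2 s hs1 hs2)
      rwa [Real.sqrt_mul (sq_nonneg C0), Real.sqrt_sq hC] at this
    · rw [h3]; exact hTpos
    · intro j hj
      have := hT hj
      rw [← h3] at this
      exact (Finset.mem_filter.mp this).2
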